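/- Propagating perpetuality to the complement: let (N,μ₀) be a perpetual free-choice system with regeneration cluster cl, let N̂ ⊆ N be a cl-adapted CP-subnet with complement N̄ = N ∖ N̂. Then for every reachable marking μ of (N,μ₀) and every shutdown sequence μ →σ→ μ_sd for N̂ at μ, the free-choice system (N̄, μ_sd|N̄) (with μ_sd restricted to the places of N̄) is perpetual with regeneration cluster cl̄ = N̄ ∩ cl. -/

import Mathlib

open Classical

/-- A (finite, bipartite) Petri *net*: disjoint finite sets of places and
transitions, and an edge relation running only between places and transitions. -/
structure Net (α : Type*) where
  places : Finset α
  transitions : Finset α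
  F : α → α → Prop
  disj : Disjoint places transitions
  edges : ∀ x y, F x y →
    (x ∈ places ∧ y ∈ transitions) ∨ (x ∈ transitions ∧ y ∈ places)

namespace Net

variable {α : Type*} [DecidableEq α]

/-- The nodes of a net. -/
def nodes (N : Net α) : Finset α := N.places ∪ N.transitions

/-- Pre-set of a node. -/
def pre (N : Net α) (x : α) : Set α := {y | N.F y x}

/-- Post-set of a node. -/
def post (N : Net α) (x : α) : Set α := {y | N.F x y}

/-- A transition `t` is enabled at a marking `μ` if every pre-place is marked. -/
def Enabled (N : Net α) (μ : α → ℕ) (t : α) : Prop :=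
  t ∈ N.transitions ∧ ∀ p, N.F p t → 1 ≤ μ p

/-- Firing a transition: remove one token from each pre-place,
add one token at each post-place. -/
noncomputable def fire (N : Net α) (t : α) (μ : α → ℕ) : α → ℕ :=
  fun p => μ p - (if N.F p t then 1 else 0) + (if N.F t p then 1 else 0)

/-- `FireSeq N μ σ ν`: the occurrence sequence `σ` is enabled at `μ` and
firing it successively leads from `μ` to `ν`. -/
inductive FireSeq (N : Net α) : (α → ℕ) → List α → (α → ℕ) → Prop
  | nil (μ : α → ℕ) : FireSeq N μ [] μ
  | cons {μ ν : α → ℕ} {t : α} {σ : List α} :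
      N.Enabled μ t → FireSeq N (N.fire t μ) σ ν → FireSeq N μ (t :: σ) ν

/-- Reachability of markings. -/
def Reach (N : Net α) (μ ν : α → ℕ) : Prop := ∃ σ : List α, N.FireSeq μ σ ν

/-- The set of transitions enabled at `μ`. -/
def en (N : Net α) (μ : α → ℕ) : Set α := {t | N.Enabled μ t}

/-- Equality of markings (as maps on the places of the net). -/
def MarkingEq (N : Net α) (μ ν : α → ℕ) : Prop := ∀ p ∈ N.places, μ p = ν p

/-- Liveness of a Petri net `(N, μ₀)`. -/
def Live (N : Net α) (μ₀ : α → ℕ) : Prop :=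
  ∀ t ∈ N.transitions, ∀ μ, N.Reach μ₀ μ → ∃ ν, N.Reach μ ν ∧ N.Enabled ν t

/-- Boundedness of a Petri net `(N, μ₀)`. -/
def Bounded (N : Net α) (μ₀ : α → ℕ) : Prop :=
  ∃ K : ℕ, ∀ μ, N.Reach μ₀ μ → ∀ p ∈ N.places, μ p ≤ K

/-- A net is well-formed if it carries a live and bounded marking. -/
def WellFormed (N : Net α) : Prop := ∃ μ₀ : α → ℕ, N.Live μ₀ ∧ N.Bounded μ₀

/-- Free-choice net: `(p,t) ∈ F` implies `•t × p• ⊆ F`. -/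
def FreeChoice (N : Net α) : Prop :=
  ∀ p ∈ N.places, ∀ t, N.F p t → ∀ p', N.F p' t → ∀ t', N.F p t' → N.F p' t'

/-- T-net: every place has exactly one pre-transition and one post-transition. -/
def IsTNet (N : Net α) : Prop :=
  ∀ p ∈ N.places, (∃! t, N.F t p) ∧ (∃! t, N.F p t)

/-- A set of nodes is cluster-closed if with each place it contains the
post-set of the place and with each transition the pre-set of the transition. -/
def ClusterClosed (N : Net α) (S : Set α) : Prop :=
  (∀ p ∈ S, p ∈ N.places → ∀ t, N.F p t → t ∈ S) ∧
  (∀ t ∈ S, t ∈ N.transitions → ∀ p, N.F p t → p ∈ S)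

/-- The cluster of a node: the smallest cluster-closed set of nodes containing it. -/
def clusterOf (N : Net α) (x : α) : Set α :=
  ⋂₀ {S : Set α | x ∈ S ∧ N.ClusterClosed S}

/-- `cl` is a cluster of `N` if it is the cluster of some node. -/
def IsCluster (N : Net α) (cl : Set α) : Prop :=
  ∃ x ∈ N.nodes, cl = N.clusterOf x

/-- The marking `μ_cl` marking exactly the places of the cluster `cl`, once. -/
noncomputable def clusterMarking (N : Net α) (cl : Set α) : α → ℕ :=
  fun p => if p ∈ cl ∧ p ∈ N.places then 1 else 0

/-- `μh` is a home marking of `(N, μ₀)`: reachable from every reachable marking. -/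
def IsHomeMarking (N : Net α) (μ₀ μh : α → ℕ) : Prop :=
  ∀ μ, N.Reach μ₀ μ → ∃ ν, N.Reach μ ν ∧ N.MarkingEq ν μh

/-- `(N, μ₀)` is perpetual with regeneration cluster `cl`: live, bounded, and
`μ_cl` is a home marking for the cluster `cl`. -/
def Perpetual (N : Net α) (μ₀ : α → ℕ) (cl : Set α) : Prop :=
  N.Live μ₀ ∧ N.Bounded μ₀ ∧ N.IsCluster cl ∧
    N.IsHomeMarking μ₀ (N.clusterMarking cl)

/-- Lucency: enabling-equivalent reachable markings are equal. -/
def Lucent (N : Net α) (μ₀ : α → ℕ) : Prop :=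
  ∀ μ₁ μ₂, N.Reach μ₀ μ₁ → N.Reach μ₀ μ₂ → N.en μ₁ = N.en μ₂ → N.MarkingEq μ₁ μ₂

/-- A path of the net: a nonempty sequence of nodes along edges. -/
def IsPath (N : Net α) (δ : List α) : Prop :=
  δ ≠ [] ∧ (∀ x ∈ δ, x ∈ N.nodes) ∧ δ.Chain' N.F

/-- A circuit: a path whose last node is connected back to its first node. -/
def IsCircuit (N : Net α) (δ : List α) : Prop :=
  N.IsPath δ ∧ ∃ h : δ ≠ [], N.F (δ.getLast h) (δ.head h)

/-- Token count of a set of nodes: total number of tokens on its places. -/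
def tokenCount (N : Net α) (μ : α → ℕ) (X : Finset α) : ℕ :=
  ∑ p ∈ X ∩ N.places, μ p

/-- The set `S` of nodes is strongly connected (in the induced subnet). -/
def StronglyConnectedOn (N : Net α) (S : Finset α) : Prop :=
  ∀ x ∈ S, ∀ y ∈ S,
    Relation.ReflTransGen (fun a b => a ∈ S ∧ b ∈ S ∧ N.F a b) x y

/-- The set `S` of nodes is weakly connected (in the induced subnet). -/
def WeaklyConnectedOn (N : Net α) (S : Finset α) : Prop :=
  ∀ x ∈ S, ∀ y ∈ S,
    Relation.ReflTransGen (fun a b => a ∈ S ∧ b ∈ S ∧ (N.F a b ∨ N.F b a)) x y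

/-- The (full) subnet spanned by `S` is transition-bordered: every place of `S`
has all its neighbours inside `S`. -/
def TransitionBordered (N : Net α) (S : Finset α) : Prop :=
  ∀ p ∈ S, p ∈ N.places → ∀ y, (N.F y p ∨ N.F p y) → y ∈ S

/-- The full subnet spanned by `S` is a T-net: each place of `S` has exactly one
pre-transition and one post-transition inside `S`. -/
def TNetOn (N : Net α) (S : Finset α) : Prop :=
  ∀ p ∈ S, p ∈ N.places →
    (∃! t, t ∈ S ∧ N.F t p) ∧ (∃! t, t ∈ S ∧ N.F p t)

/-- `S` spans a CP-subnet of `N`: nonempty, weakly connected, transition-bordered,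
a T-net, and the complement contains a transition and is strongly connected. -/
def IsCPSubnet (N : Net α) (S : Finset α) : Prop :=
  S.Nonempty ∧ S ⊆ N.nodes ∧ N.WeaklyConnectedOn S ∧ N.TransitionBordered S ∧
  N.TNetOn S ∧ ((N.nodes \ S) ∩ N.transitions).Nonempty ∧
  N.StronglyConnectedOn (N.nodes \ S)

/-- The full subnet of `N` spanned by the node set `S`, as a net. -/
def restrict (N : Net α) (S : Finset α) : Net α where
  places := N.places ∩ S
  transitions := N.transitions ∩ S
  F := fun x y => x ∈ S ∧ y ∈ S ∧ N.F x y
  disj := N.disj.mono Finset.inter_subset_left Finset.inter_subset_left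
  edges := by
    rintro x y ⟨hx, hy, hF⟩
    rcases N.edges x y hF with ⟨h1, h2⟩ | ⟨h1, h2⟩
    · exact Or.inl ⟨Finset.mem_inter.mpr ⟨h1, hx⟩, Finset.mem_inter.mpr ⟨h2, hy⟩⟩
    · exact Or.inr ⟨Finset.mem_inter.mpr ⟨h1, hx⟩, Finset.mem_inter.mpr ⟨h2, hy⟩⟩

/-- A CP-exhaustion: a family of pairwise disjoint CP-subnets whose complement
is a strongly connected T-net. -/
def IsCPExhaustion (N : Net α) {n : ℕ}
    (Nhat : Fin n → Finset α) : Prop :=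
  (∀ i, N.IsCPSubnet (Nhat i)) ∧
  (∀ i j, i ≠ j → Disjoint (Nhat i) (Nhat j)) ∧
  N.StronglyConnectedOn (N.nodes \ Finset.univ.biUnion Nhat) ∧
  N.TNetOn (N.nodes \ Finset.univ.biUnion Nhat)

/-- `t` is a way-in transition of the subnet spanned by `S`: a transition of `S`
with a pre-place outside `S`. -/
def IsWayIn (N : Net α) (S : Finset α) (t : α) : Prop :=
  t ∈ S ∧ t ∈ N.transitions ∧ ∃ p ∈ N.places, p ∉ S ∧ N.F p t

/-- A shutdown sequence for the subnet spanned by `S` (with way-in transition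
`tin`) at a marking `μ`: an occurrence sequence enabled at `μ` using only
transitions of `S` other than `tin`, after which no transition of `S` other
than (possibly) `tin` is enabled. -/
def IsShutdownSeq (N : Net α) (S : Finset α) (tin : α)
    (μ : α → ℕ) (σ : List α) (μsd : α → ℕ) : Prop :=
  N.FireSeq μ σ μsd ∧
  (∀ t ∈ σ, t ∈ S ∧ t ∈ N.transitions ∧ t ≠ tin) ∧
  (∀ t ∈ S, t ∈ N.transitions → t ≠ tin → ¬ N.Enabled μsd t)

/-- `C` spans a P-component of `N`: nonempty, strongly connected, inside `C`
every transition has exactly one pre-place and one post-place, and every place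
of `C` has all its neighbours inside `C`. -/
def IsPComponent (N : Net α) (C : Finset α) : Prop :=
  C.Nonempty ∧ C ⊆ N.nodes ∧ N.StronglyConnectedOn C ∧
  (∀ t ∈ C, t ∈ N.transitions →
    (∃! p, p ∈ C ∧ N.F p t) ∧ (∃! p, p ∈ C ∧ N.F t p)) ∧
  (∀ p ∈ C, p ∈ N.places → ∀ y, (N.F y p ∨ N.F p y) → y ∈ C)

end Net
namespace Net

section Firing

variable {α : Type*} {N : Net α}

/-- The number of tokens put on `p` when every transition `t` fires `x t` times. -/
noncomputable def inflow (N : Net α) (x : α → ℤ) (p : α) : ℤ :=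
  ∑ t ∈ N.transitions.filter (fun t => N.F t p), x t

/-- The number of tokens taken from `p` when every transition `t` fires `x t` times. -/
noncomputable def outflow (N : Net α) (x : α → ℤ) (p : α) : ℤ :=
  ∑ t ∈ N.transitions.filter (fun t => N.F p t), x t

/-- The transition `u` can be enabled again from every marking reachable from `M`. -/
def LiveAt (N : Net α) (M : α → ℕ) (u : α) : Prop :=
  ∀ ν, N.Reach M ν → ∃ ν', N.Reach ν ν' ∧ N.Enabled ν' u

lemma place_of_F_transition {p t : α} (h : N.F p t) (ht : t ∈ N.transitions) :
    p ∈ N.places := by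
  rcases N.edges p t h with h1 | h1
  · exact h1.1
  · exact absurd ht (Finset.disjoint_left.mp N.disj h1.2)

lemma place_of_transition_F {p t : α} (h : N.F t p) (ht : t ∈ N.transitions) :
    p ∈ N.places := by
  rcases N.edges t p h with h1 | h1
  · exact absurd ht (Finset.disjoint_left.mp N.disj h1.1)
  · exact h1.2

lemma transition_of_place_F {p t : α} (h : N.F p t) (hp : p ∈ N.places) :
    t ∈ N.transitions := by
  rcases N.edges p t h with h1 | h1
  · exact h1.2
  · exact absurd h1.1 (Finset.disjoint_left.mp N.disj hp)

lemma transition_of_F_place {p t : α} (h : N.F t p) (hp : p ∈ N.places) :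
    t ∈ N.transitions := by
  rcases N.edges t p h with h1 | h1
  · exact absurd h1.2 (Finset.disjoint_left.mp N.disj hp)
  · exact h1.1

lemma FreeChoice.pre_iff (hfc : N.FreeChoice) {p t t' : α} (hp : p ∈ N.places)
    (h : N.F p t) (h' : N.F p t') (q : α) : N.F q t ↔ N.F q t' :=
  ⟨fun hq => hfc p hp t h q hq t' h', fun hq => hfc p hp t' h' q hq t h⟩

lemma Enabled.of_pre_iff {M : α → ℕ} {t t' : α} (h : N.Enabled M t)
    (ht' : t' ∈ N.transitions) (hpre : ∀ q, N.F q t ↔ N.F q t') : N.Enabled M t' :=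
  ⟨ht', fun p hp => h.2 p ((hpre p).mpr hp)⟩

lemma FireSeq.append {μ ν ξ : α → ℕ} {σ τ : List α} (h : N.FireSeq μ σ ν)
    (h' : N.FireSeq ν τ ξ) : N.FireSeq μ (σ ++ τ) ξ := by
  induction h with
  | nil => exact h'
  | cons he _ ih => exact FireSeq.cons he (ih h')

lemma Reach.refl (μ : α → ℕ) : N.Reach μ μ := ⟨[], FireSeq.nil μ⟩

lemma Reach.trans {μ ν ξ : α → ℕ} (h : N.Reach μ ν) (h' : N.Reach ν ξ) : N.Reach μ ξ := by
  obtain ⟨σ, hσ⟩ := h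
  obtain ⟨τ, hτ⟩ := h'
  exact ⟨σ ++ τ, hσ.append hτ⟩

lemma Enabled.reach_fire {M : α → ℕ} {t : α} (h : N.Enabled M t) :
    N.Reach M (N.fire t M) := ⟨[t], FireSeq.cons h (FireSeq.nil _)⟩

lemma FireSeq.exists_enabled_of_mem {μ ν : α → ℕ} {σ : List α} (h : N.FireSeq μ σ ν) {v : α}
    (hv : v ∈ σ) : ∃ M, N.Reach μ M ∧ N.Enabled M v := by
  induction h with
  | nil => simp at hv
  | cons he _ ih =>
    rcases List.mem_cons.mp hv with rfl | hv
    · exact ⟨_, Reach.refl _, he⟩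
    · obtain ⟨M, hM, hMv⟩ := ih hv
      exact ⟨M, he.reach_fire.trans hM, hMv⟩

lemma fire_eq {M : α → ℕ} {t : α} (h : N.Enabled M t) (p : α) :
    (N.fire t M p : ℤ) + (if N.F p t then 1 else 0) = M p + (if N.F t p then 1 else 0) := by
  have := h.2 p
  unfold fire
  split_ifs with h1 h2 <;> simp_all

/-- If the pre-places of `Z` are fed only by `Z`, then the transitions of an occurrence
sequence lying outside `Z` can be dropped. -/
lemma FireSeq.filter {μ ν : α → ℕ} {σ : List α} (h : N.FireSeq μ σ ν) (Z : Set α)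
    (hZ : ∀ t ∈ Z, ∀ q, N.F q t → ∀ u, N.F u q → u ∈ Z) (μ' : α → ℕ)
    (hμ : ∀ t ∈ Z, ∀ q, N.F q t → μ q ≤ μ' q) :
    ∃ ν', N.FireSeq μ' (σ.filter (fun t => decide (t ∈ Z))) ν' := by
  induction h generalizing μ' with
  | nil => exact ⟨μ', FireSeq.nil μ'⟩
  | @cons μ ν t σ he _ ih =>
    by_cases ht : t ∈ Z
    · have he' : N.Enabled μ' t := ⟨he.1, fun p hp => (he.2 p hp).trans (hμ t ht p hp)⟩
      obtain ⟨ν', hν'⟩ := ih (N.fire t μ') (by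
        intro s hs q hq
        have := hμ s hs q hq
        unfold fire
        split_ifs <;> omega)
      refine ⟨ν', ?_⟩
      rw [List.filter_cons_of_pos (by simpa using ht)]
      exact FireSeq.cons he' hν'
    · rw [List.filter_cons_of_neg (by simpa using ht)]
      refine ih μ' fun s hs q hq => ?_
      have := hμ s hs q hq
      have hnot : ¬ N.F t q := fun htq => ht (hZ s hs q hq t htq)
      unfold fire
      simp only [hnot, if_false]
      omega

lemma LiveAt.mono {M M' : α → ℕ} {u : α} (h : N.LiveAt M u) (hM : N.Reach M M') :
    N.LiveAt M' u := fun ν hν => h ν (hM.trans hν)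

lemma Live.liveAt {μ₀ M : α → ℕ} (h : N.Live μ₀) (hM : N.Reach μ₀ M) {t : α}
    (ht : t ∈ N.transitions) : N.LiveAt M t := fun ν hν => h t ht ν (hM.trans hν)

lemma LiveAt.exists_enabled {M : α → ℕ} {t : α} (h : N.LiveAt M t) : ∃ u, N.Enabled M u := by
  obtain ⟨ν, ⟨σ, hσ⟩, he⟩ := h M (Reach.refl M)
  cases hσ with
  | nil => exact ⟨t, he⟩
  | cons he' _ => exact ⟨_, he'⟩

variable [DecidableEq α]

lemma inflow_count_cons {t : α} (ht : t ∈ N.transitions) (σ : List α) (p : α) :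
    N.inflow (fun u => ((t :: σ).count u : ℤ)) p =
      N.inflow (fun u => (σ.count u : ℤ)) p + (if N.F t p then 1 else 0) := by
  simp [inflow, List.count_cons, Finset.sum_add_distrib, ht]

lemma outflow_count_cons {t : α} (ht : t ∈ N.transitions) (σ : List α) (p : α) :
    N.outflow (fun u => ((t :: σ).count u : ℤ)) p =
      N.outflow (fun u => (σ.count u : ℤ)) p + (if N.F p t then 1 else 0) := by
  simp [outflow, List.count_cons, Finset.sum_add_distrib, ht]

/-- The state equation. -/
lemma FireSeq.state_equation {μ ν : α → ℕ} {σ : List α} (h : N.FireSeq μ σ ν) (p : α) :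
    (ν p : ℤ) + N.outflow (fun t => (σ.count t : ℤ)) p =
      μ p + N.inflow (fun t => (σ.count t : ℤ)) p := by
  induction h with
  | nil => simp [inflow, outflow]
  | cons he _ ih =>
    rw [inflow_count_cons he.1, outflow_count_cons he.1]
    have := fire_eq he p
    linarith

lemma LiveAt.exists_count_ge {M : α → ℕ} {u : α} (h : N.LiveAt M u) (n : ℕ) :
    ∃ σ ν, N.FireSeq M σ ν ∧ n ≤ σ.count u := by
  induction n with
  | zero => exact ⟨[], M, FireSeq.nil M, Nat.zero_le _⟩
  | succ n ih =>
    obtain ⟨σ, ν, hσ, hn⟩ := ih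
    obtain ⟨ν', ⟨τ, hτ⟩, he⟩ := h ν ⟨σ, hσ⟩
    refine ⟨σ ++ (τ ++ [u]), N.fire u ν',
      hσ.append (hτ.append (FireSeq.cons he (FireSeq.nil _))), ?_⟩
    simp only [List.count_append, List.count_singleton_self]
    omega

/-- A place all of whose consumers are absent from an occurrence sequence
collects every token put on it. -/
lemma FireSeq.count_le_of_no_consumer {μ ν : α → ℕ} {σ : List α} (h : N.FireSeq μ σ ν)
    {u p : α} (hu : u ∈ N.transitions) (hup : N.F u p) (hp : ∀ v, N.F p v → v ∉ σ) :
    σ.count u ≤ ν p := by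
  have hs := h.state_equation p
  have hout : N.outflow (fun t => (σ.count t : ℤ)) p = 0 := by
    refine Finset.sum_eq_zero fun t ht => ?_
    simp [List.count_eq_zero_of_not_mem (hp t (Finset.mem_filter.mp ht).2)]
  have hin : (σ.count u : ℤ) ≤ N.inflow (fun t => (σ.count t : ℤ)) p :=
    Finset.single_le_sum (f := fun t => (σ.count t : ℤ)) (fun t _ => by positivity)
      (Finset.mem_filter.mpr ⟨hu, hup⟩)
  omega

end Firing

section Liveness

variable {α : Type*} [DecidableEq α] {N : Net α}

/-- From every marking one can reach a marking at which every transition is dead or live. -/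
lemma exists_reach_dead_or_liveAt (N : Net α) (M : α → ℕ) (s : Finset α) :
    ∃ M', N.Reach M M' ∧
      ∀ u ∈ s, (∀ ν, N.Reach M' ν → ¬ N.Enabled ν u) ∨ N.LiveAt M' u := by
  induction s using Finset.induction_on with
  | empty => exact ⟨M, Reach.refl M, by simp⟩
  | insert u s _ ih =>
    obtain ⟨M', hM', hs⟩ := ih
    by_cases hu : N.LiveAt M' u
    · refine ⟨M', hM', fun v hv => ?_⟩
      rcases Finset.mem_insert.mp hv with rfl | hv
      · exact Or.inr hu
      · exact hs v hv
    · unfold LiveAt at hu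
      push Not at hu
      obtain ⟨M₂, hM₂, hdead⟩ := hu
      refine ⟨M₂, hM'.trans hM₂, fun v hv => ?_⟩
      rcases Finset.mem_insert.mp hv with rfl | hv
      · exact Or.inl hdead
      · exact (hs v hv).imp (fun h ν hν => h ν (hM₂.trans hν)) (fun h => h.mono hM₂)

/-- A bounded, deadlock-free free-choice system on a strongly connected net is live. -/
lemma live_of_deadlockFree {μ₀ : α → ℕ} (hfc : N.FreeChoice) (hb : N.Bounded μ₀)
    (hsc : N.StronglyConnectedOn N.nodes)
    (hdf : ∀ M, N.Reach μ₀ M → ∃ t, N.Enabled M t) : N.Live μ₀ := by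
  intro t ht M hM
  by_contra hcon
  push Not at hcon
  obtain ⟨M', hM', hdl⟩ := N.exists_reach_dead_or_liveAt M N.transitions
  obtain ⟨K, hK⟩ := hb
  obtain ⟨u₀, hu₀⟩ := hdf M' (hM.trans hM')
  have hu₀L : N.LiveAt M' u₀ :=
    (hdl u₀ hu₀.1).resolve_left fun h => h M' (Reach.refl _) hu₀
  have hfwd : ∀ u p v, u ∈ N.transitions → N.LiveAt M' u → N.F u p → N.F p v →
      N.LiveAt M' v := by
    intro u p v hu hL hup hpv
    have hp := place_of_transition_F hup hu
    refine (hdl v (transition_of_place_F hpv hp)).resolve_left fun hdead => ?_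
    obtain ⟨σ, ν, hσ, hn⟩ := hL.exists_count_ge (K + 1)
    have hle := hσ.count_le_of_no_consumer hu hup fun w hw hwσ => by
      obtain ⟨ξ, hξ, he⟩ := hσ.exists_enabled_of_mem hwσ
      exact hdead ξ hξ (he.of_pre_iff (transition_of_place_F hpv hp) (hfc.pre_iff hp hw hpv))
    have := hK ν ((hM.trans hM').trans ⟨σ, hσ⟩) p hp
    omega
  have hpath : ∀ y, Relation.ReflTransGen
      (fun a b => a ∈ N.nodes ∧ b ∈ N.nodes ∧ N.F a b) u₀ y →
      (y ∈ N.transitions → N.LiveAt M' y) ∧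
        (y ∈ N.places → ∀ v, N.F y v → N.LiveAt M' v) := by
    intro y hy
    induction hy with
    | refl =>
      exact ⟨fun _ => hu₀L, fun h => absurd hu₀.1 (Finset.disjoint_left.mp N.disj h)⟩
    | @tail b c _ hbc ih =>
      refine ⟨fun hc => ih.2 (place_of_F_transition hbc.2.2 hc) c hbc.2.2, fun hc v hv => ?_⟩
      have hb' := transition_of_F_place hbc.2.2 hc
      exact hfwd b c v hb' (ih.1 hb') hbc.2.2 hv
  obtain ⟨ν, hν, he⟩ := (hpath t (hsc u₀ (Finset.mem_union_right _ hu₀.1) t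
    (Finset.mem_union_right _ ht))).1 ht M' (Reach.refl _)
  exact hcon ν (hM'.trans hν) he

end Liveness

section Conservation

variable {α : Type*} [DecidableEq α] {N : Net α} {μ₀ : α → ℕ}

/-- In a live and bounded system, every place fed by a set `Z` of transitions whose pre-places
are fed only by `Z` has a consumer in `Z`. -/
lemma exists_consumer_of_backward_closed (hl : N.Live μ₀) (hb : N.Bounded μ₀) {Z : Set α}
    (hZ : ∀ t ∈ Z, ∀ q, N.F q t → ∀ u, N.F u q → u ∈ Z) {u p : α} (hu : u ∈ N.transitions)
    (huZ : u ∈ Z) (hup : N.F u p) : ∃ v ∈ Z, N.F p v := by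
  by_contra hcon
  push Not at hcon
  obtain ⟨K, hK⟩ := hb
  obtain ⟨σ, ν, hσ, hn⟩ := (hl.liveAt (Reach.refl _) hu).exists_count_ge (K + 1)
  obtain ⟨ν', hν'⟩ := hσ.filter Z hZ μ₀ fun _ _ _ _ => le_rfl
  have hle := hν'.count_le_of_no_consumer hu hup fun v hpv hv =>
    hcon v (by simpa using (List.mem_filter.mp hv).2) hpv
  rw [List.count_filter (by simpa using huZ)] at hle
  have := hK ν' ⟨_, hν'⟩ p (place_of_transition_F hup hu)
  omega

/-- In a live and bounded weakly connected free-choice net, a nonempty set of transitions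
which is closed under clusters and under predecessors contains all transitions. -/
lemma mem_of_backward_closed (hfc : N.FreeChoice) (hl : N.Live μ₀) (hb : N.Bounded μ₀)
    (hw : N.WeaklyConnectedOn N.nodes) {Z : Set α} {t₀ : α} (ht₀ : t₀ ∈ N.transitions)
    (ht₀Z : t₀ ∈ Z) (hZ : ∀ t ∈ Z, ∀ q, N.F q t → ∀ u, N.F u q → u ∈ Z)
    (hcl : ∀ t ∈ Z, ∀ t' ∈ N.transitions, (∀ q, N.F q t ↔ N.F q t') → t' ∈ Z)
    {t : α} (ht : t ∈ N.transitions) : t ∈ Z := by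
  have hcons : ∀ p ∈ N.places, ∀ v ∈ Z, N.F p v → ∀ v', N.F p v' → v' ∈ Z :=
    fun p hp v hv hpv v' hpv' =>
      hcl v hv v' (transition_of_place_F hpv' hp) (hfc.pre_iff hp hpv hpv')
  have hpath : ∀ y, Relation.ReflTransGen
      (fun a b => a ∈ N.nodes ∧ b ∈ N.nodes ∧ (N.F a b ∨ N.F b a)) t₀ y →
      (y ∈ N.transitions → y ∈ Z) ∧
        (y ∈ N.places → ∀ v, N.F y v ∨ N.F v y → v ∈ Z) := by
    intro y hy
    induction hy with
    | refl =>
      exact ⟨fun _ => ht₀Z, fun h => absurd ht₀ (Finset.disjoint_left.mp N.disj h)⟩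
    | @tail b c _ hbc ih =>
      obtain ⟨-, -, hbc⟩ := hbc
      refine ⟨fun hc => ih.2 ?_ c hbc, fun hc => ?_⟩
      · exact hbc.elim (place_of_F_transition · hc) (place_of_transition_F · hc)
      · have hbT : b ∈ N.transitions :=
          hbc.elim (transition_of_F_place · hc) (transition_of_place_F · hc)
        have hbZ := ih.1 hbT
        obtain ⟨v, hvZ, hcv⟩ : ∃ v ∈ Z, N.F c v := by
          rcases hbc with h | h
          · exact exists_consumer_of_backward_closed hl hb hZ hbT hbZ h
          · exact ⟨b, hbZ, h⟩
        rintro w (hw | hw)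
        · exact hcons c hc v hvZ hcv w hw
        · exact hZ v hvZ c hcv w hw
  exact (hpath t (hw t₀ (Finset.mem_union_right _ ht₀) t (Finset.mem_union_right _ ht))).1 ht

/-- A stage of a run which fires the transitions of each cluster in the proportions given
by `a`: `x` counts the firings and `m` the rounds completed by each cluster. -/
structure RoutedRun (N : Net α) (μ₀ : α → ℕ) (a : α → ℕ) where
  M : α → ℕ
  σ : List α
  m : α → ℕ
  fireSeq : N.FireSeq μ₀ σ M
  rounds : ∀ t ∈ N.transitions, ∀ t' ∈ N.transitions, (∀ q, N.F q t ↔ N.F q t') → m t = m t'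
  lower : ∀ t ∈ N.transitions, m t * a t ≤ σ.count t
  upper : ∀ t ∈ N.transitions, σ.count t ≤ m t * a t + a t

lemma RoutedRun.exists_next {a : α → ℕ} (hl : N.Live μ₀) (hT : N.transitions.Nonempty)
    (r : RoutedRun N μ₀ a) : ∃ r' : RoutedRun N μ₀ a,
      (∀ t, r.m t ≤ r'.m t) ∧ (∀ t, r.σ.count t ≤ r'.σ.count t) ∧
      ∃ t ∈ N.transitions, r.m t < r'.m t ∨ r.σ.count t < r'.σ.count t := by
  obtain ⟨t₀, ht₀⟩ := hT
  obtain ⟨u, hu⟩ := (hl.liveAt ⟨r.σ, r.fireSeq⟩ ht₀).exists_enabled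
  by_cases h : ∃ t ∈ N.transitions, (∀ q, N.F q u ↔ N.F q t) ∧
      r.σ.count t < r.m t * a t + a t
  · obtain ⟨t, ht, hut, hlt⟩ := h
    have hcount : ∀ s, (r.σ ++ [t]).count s = r.σ.count s + if t = s then 1 else 0 := by
      intro s
      simp [List.count_append, List.count_singleton]
    refine ⟨⟨N.fire t r.M, r.σ ++ [t], r.m,
      r.fireSeq.append (FireSeq.cons (hu.of_pre_iff ht hut) (FireSeq.nil _)), r.rounds, ?_, ?_⟩,
      fun _ => le_rfl, ?_, t, ht, Or.inr ?_⟩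
    · intro s hs
      have := r.lower s hs
      rw [hcount]
      omega
    · intro s hs
      have := r.upper s hs
      rw [hcount]
      split_ifs with hts
      · subst hts
        omega
      · omega
    · intro s
      simp only [hcount]
      omega
    · simp [hcount]
  · push Not at h
    refine ⟨⟨r.M, r.σ, fun t => if (∀ q, N.F q u ↔ N.F q t) then r.m t + 1 else r.m t,
      r.fireSeq, ?_, ?_, ?_⟩, ?_, fun _ => le_rfl, u, hu.1, Or.inl ?_⟩
    · intro t ht t' ht' htt'
      have : (∀ q, N.F q u ↔ N.F q t) ↔ (∀ q, N.F q u ↔ N.F q t') := by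
        simp only [htt']
      simp only [this, r.rounds t ht t' ht' htt']
    · intro t ht
      have := r.lower t ht
      split_ifs with h1
      · have := h t ht h1
        rw [add_mul, one_mul]
        exact this
      · exact this
    · intro t ht
      have := r.upper t ht
      split_ifs with h1
      · rw [add_mul, one_mul]
        omega
      · exact this
    · intro t
      dsimp only
      split_ifs <;> omega
    · simp

/-- A live and bounded system has a cyclic firing vector which on each cluster is a multiple
of a prescribed vector `a`. -/
lemma exists_proportional_invariant (hl : N.Live μ₀) (hb : N.Bounded μ₀)
    (hT : N.transitions.Nonempty) (a : α → ℕ) :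
    ∃ δ : α → ℕ, (∃ t ∈ N.transitions, 0 < δ t) ∧
      (∀ t ∈ N.transitions, ∀ t' ∈ N.transitions,
        (∀ q, N.F q t ↔ N.F q t') → δ t = δ t') ∧
      ∀ p ∈ N.places, N.inflow (fun t => (δ t * a t : ℤ)) p =
        N.outflow (fun t => (δ t * a t : ℤ)) p := by
  obtain ⟨K, hK⟩ := hb
  choose next hm hc hstep using fun r : RoutedRun N μ₀ a => r.exists_next hl hT
  let r₀ : RoutedRun N μ₀ a :=
    ⟨μ₀, [], fun _ => 0, FireSeq.nil _, by simp, by simp, by simp⟩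
  let f : ℕ → RoutedRun N μ₀ a := fun n => next^[n] r₀
  have hf : ∀ n, f (n + 1) = next (f n) := fun n => Function.iterate_succ_apply' next n r₀
  have hmono_m : ∀ t, Monotone fun n => (f n).m t :=
    fun t => monotone_nat_of_le_succ fun n => by rw [hf]; exact hm _ t
  have hmono_c : ∀ t, Monotone fun n => (f n).σ.count t :=
    fun t => monotone_nat_of_le_succ fun n => by rw [hf]; exact hc _ t
  let g : ℕ → (N.places → Fin (K + 1)) × ((t : N.transitions) → Fin (a t + 1)) := fun n =>
    (fun p => ⟨(f n).M p, Nat.lt_succ_of_le (hK _ ⟨_, (f n).fireSeq⟩ p p.2)⟩,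
     fun t => ⟨(f n).σ.count t.1 - (f n).m t * a t, by
        have := (f n).upper t t.2
        omega⟩)
  obtain ⟨i, j, hij, hg⟩ : ∃ i j, i < j ∧ g i = g j := by
    obtain ⟨i, j, hne, hg⟩ := Finite.exists_ne_map_eq_of_infinite g
    rcases lt_or_gt_of_ne hne with h | h
    · exact ⟨i, j, h, hg⟩
    · exact ⟨j, i, h, hg.symm⟩
  have hM : ∀ p ∈ N.places, (f i).M p = (f j).M p := fun p hp =>
    congrArg Fin.val (congrFun (congrArg Prod.fst hg) ⟨p, hp⟩)
  have hres : ∀ t ∈ N.transitions,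
      ((f j).σ.count t : ℤ) - (f i).σ.count t = ((f j).m t - (f i).m t : ℕ) * a t := by
    intro t ht
    have h1 : (f i).σ.count t - (f i).m t * a t = (f j).σ.count t - (f j).m t * a t :=
      congrArg Fin.val (congrFun (congrArg Prod.snd hg) ⟨t, ht⟩)
    have h2 := (f i).lower t ht
    have h3 := (f j).lower t ht
    have h4 : (f i).m t ≤ (f j).m t := hmono_m t hij.le
    zify [h2, h3] at h1
    push_cast [h4]
    linarith
  refine ⟨fun t => (f j).m t - (f i).m t, ?_, ?_, ?_⟩
  · obtain ⟨t, ht, hlt⟩ := hstep (f i)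
    rw [← hf] at hlt
    refine ⟨t, ht, ?_⟩
    change 0 < (f j).m t - (f i).m t
    have h1 : (f (i + 1)).m t ≤ (f j).m t := hmono_m t hij
    have h2 : (f (i + 1)).σ.count t ≤ (f j).σ.count t := hmono_c t hij
    rcases hlt with h | h
    · omega
    · by_contra h0
      have h3 := hres t ht
      have h4 : (f j).m t - (f i).m t = 0 := by omega
      rw [h4] at h3
      simp at h3
      omega
  · intro t ht t' ht' htt'
    simp only [(f i).rounds t ht t' ht' htt', (f j).rounds t ht t' ht' htt']
  · intro p hp
    have h1 := (f i).fireSeq.state_equation p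
    have h2 := (f j).fireSeq.state_equation p
    rw [hM p hp] at h1
    have h3 : N.inflow (fun t => (((f j).m t - (f i).m t : ℕ) * a t : ℤ)) p =
        N.inflow (fun t => ((f j).σ.count t : ℤ)) p -
          N.inflow (fun t => ((f i).σ.count t : ℤ)) p := by
      simp only [inflow, ← Finset.sum_sub_distrib]
      exact Finset.sum_congr rfl fun t ht => (hres t (Finset.mem_filter.mp ht).1).symm
    have h4 : N.outflow (fun t => (((f j).m t - (f i).m t : ℕ) * a t : ℤ)) p =
        N.outflow (fun t => ((f j).σ.count t : ℤ)) p -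
          N.outflow (fun t => ((f i).σ.count t : ℤ)) p := by
      simp only [outflow, ← Finset.sum_sub_distrib]
      exact Finset.sum_congr rfl fun t ht => (hres t (Finset.mem_filter.mp ht).1).symm
    rw [h3, h4]
    linarith

/-- In a live and bounded weakly connected free-choice system, a positive firing vector which
loses no tokens on any place gains none either. -/
lemma inflow_eq_outflow_of_le (hfc : N.FreeChoice) (hl : N.Live μ₀) (hb : N.Bounded μ₀)
    (hw : N.WeaklyConnectedOn N.nodes) {a : α → ℕ} (ha : ∀ t ∈ N.transitions, 1 ≤ a t)
    (hle : ∀ p ∈ N.places, N.outflow (fun t => (a t : ℤ)) p ≤ N.inflow (fun t => (a t : ℤ)) p)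
    {p : α} (hp : p ∈ N.places) :
    N.inflow (fun t => (a t : ℤ)) p = N.outflow (fun t => (a t : ℤ)) p := by
  by_cases hT : N.transitions.Nonempty
  swap
  · simp [inflow, outflow, Finset.not_nonempty_iff_eq_empty.mp hT]
  obtain ⟨δ, ⟨t₁, ht₁, hδ₁⟩, hδ, hinv⟩ := exists_proportional_invariant hl hb hT a
  obtain ⟨t₀, ht₀, hmin⟩ := N.transitions.exists_min_image δ hT
  have hout : ∀ q ∈ N.places, ∀ v, N.F q v →
      N.outflow (fun t => (δ t * a t : ℤ)) q = δ v * N.outflow (fun t => (a t : ℤ)) q := by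
    intro q hq v hqv
    rw [outflow, outflow, Finset.mul_sum]
    refine Finset.sum_congr rfl fun t ht => ?_
    obtain ⟨ht, hqt⟩ := Finset.mem_filter.mp ht
    rw [hδ t ht v (transition_of_place_F hqv hq) (hfc.pre_iff hq hqt hqv)]
  have hback : ∀ t ∈ {t | t ∈ N.transitions ∧ δ t = δ t₀}, ∀ q, N.F q t → ∀ u, N.F u q →
      u ∈ {t | t ∈ N.transitions ∧ δ t = δ t₀} := by
    rintro t ⟨ht, htδ⟩ q hqt u huq
    have hq := place_of_F_transition hqt ht
    have hu := transition_of_F_place huq hq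
    refine ⟨hu, ?_⟩
    have h1 := hinv q hq
    rw [hout q hq t hqt, htδ] at h1
    have h2 := mul_le_mul_of_nonneg_left (hle q hq) (Int.natCast_nonneg (δ t₀))
    have h3 : N.inflow (fun t => (δ t * a t : ℤ)) q - δ t₀ * N.inflow (fun t => (a t : ℤ)) q =
        ∑ t ∈ N.transitions.filter (fun t => N.F t q), ((δ t : ℤ) - δ t₀) * a t := by
      simp only [inflow, Finset.mul_sum, ← Finset.sum_sub_distrib, sub_mul]
    have hnn : ∀ s ∈ N.transitions.filter (fun t => N.F t q),
        0 ≤ ((δ s : ℤ) - δ t₀) * a s := by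
      intro s hs
      have := hmin s (Finset.mem_filter.mp hs).1
      exact mul_nonneg (by omega) (by positivity)
    have h4 := Finset.single_le_sum hnn (Finset.mem_filter.mpr ⟨hu, huq⟩)
    have h5 := hnn u (Finset.mem_filter.mpr ⟨hu, huq⟩)
    have h6 : ((δ u : ℤ) - δ t₀) * a u = 0 := by linarith
    have h7 := ha u hu
    rcases mul_eq_zero.mp h6 with h | h <;> omega
  have hconst : ∀ t ∈ N.transitions, δ t = δ t₀ := fun t ht =>
    (mem_of_backward_closed hfc hl hb hw ht₀
      (Z := {t | t ∈ N.transitions ∧ δ t = δ t₀}) ⟨ht₀, rfl⟩ hback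
      (fun s hs s' hs' hss' => ⟨hs', (hδ s hs.1 s' hs' hss').symm.trans hs.2⟩) ht).2
  have hpos : (0 : ℤ) < δ t₀ := by
    rw [← hconst t₁ ht₁]
    exact_mod_cast hδ₁
  have h := hinv p hp
  have hin : N.inflow (fun t => (δ t * a t : ℤ)) p = δ t₀ * N.inflow (fun t => (a t : ℤ)) p := by
    rw [inflow, inflow, Finset.mul_sum]
    exact Finset.sum_congr rfl fun t ht => by rw [hconst t (Finset.mem_filter.mp ht).1]
  have hout' : N.outflow (fun t => (δ t * a t : ℤ)) p =
      δ t₀ * N.outflow (fun t => (a t : ℤ)) p := by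
    rw [outflow, outflow, Finset.mul_sum]
    exact Finset.sum_congr rfl fun t ht => by rw [hconst t (Finset.mem_filter.mp ht).1]
  rw [hin, hout'] at h
  exact mul_left_cancel₀ hpos.ne' h

lemma Live.exists_fireSeq_all_mem {M : α → ℕ} (hl : N.Live μ₀) (hM : N.Reach μ₀ M)
    {s : Finset α} (hs : s ⊆ N.transitions) :
    ∃ σ ν, N.FireSeq M σ ν ∧ ∀ u ∈ s, u ∈ σ := by
  induction s using Finset.induction_on with
  | empty => exact ⟨[], M, FireSeq.nil M, by simp⟩
  | insert u s _ ih =>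
    obtain ⟨σ, ν, hσ, hmem⟩ := ih fun x hx => hs (Finset.mem_insert_of_mem hx)
    obtain ⟨ν', ⟨τ, hτ⟩, he⟩ :=
      hl.liveAt hM (hs (Finset.mem_insert_self u s)) ν ⟨σ, hσ⟩
    refine ⟨σ ++ (τ ++ [u]), N.fire u ν',
      hσ.append (hτ.append (FireSeq.cons he (FireSeq.nil _))), fun v hv => ?_⟩
    rcases Finset.mem_insert.mp hv with rfl | hv
    · simp
    · simp [hmem v hv]

/-- In a live and bounded weakly connected free-choice system, the only reachable marking
covering a home marking is the home marking itself. -/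
lemma IsHomeMarking.eq_of_le {μh M : α → ℕ} (hfc : N.FreeChoice) (hl : N.Live μ₀)
    (hb : N.Bounded μ₀) (hw : N.WeaklyConnectedOn N.nodes) (hh : N.IsHomeMarking μ₀ μh)
    (hM : N.Reach μ₀ M) (hle : ∀ p ∈ N.places, μh p ≤ M p) : N.MarkingEq M μh := by
  obtain ⟨ν, ⟨τ, hτ⟩, hν⟩ := hh M hM
  have hMν := hM.trans ⟨τ, hτ⟩
  obtain ⟨ρ, ξ, hρ, hρT⟩ := hl.exists_fireSeq_all_mem hMν subset_rfl
  obtain ⟨ν', ⟨ρ', hρ'⟩, hν'⟩ := hh ξ (hMν.trans ⟨ρ, hρ⟩)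
  have hcyc := hρ.append hρ'
  set ζ := ρ ++ ρ' with hζ
  have hζ1 : ∀ t ∈ N.transitions, 1 ≤ ζ.count t := fun t ht =>
    List.one_le_count_iff.mpr (List.mem_append_left _ (hρT t ht))
  let a : α → ℕ := fun t => (τ.length + 1) * ζ.count t - τ.count t
  have hlt : ∀ t ∈ N.transitions, τ.count t + 1 ≤ (τ.length + 1) * ζ.count t := fun t ht =>
    (Nat.succ_le_succ List.count_le_length).trans (Nat.le_mul_of_pos_right _ (hζ1 t ht))
  have hacast : ∀ t ∈ N.transitions,
      (a t : ℤ) = (τ.length + 1) * ζ.count t - τ.count t := by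
    intro t ht
    have := hlt t ht
    simp only [a]
    push_cast [show τ.count t ≤ (τ.length + 1) * ζ.count t by omega]
    ring
  have hain : ∀ p, N.inflow (fun t => (a t : ℤ)) p =
      (τ.length + 1) * N.inflow (fun t => (ζ.count t : ℤ)) p -
        N.inflow (fun t => (τ.count t : ℤ)) p := by
    intro p
    simp only [inflow, Finset.mul_sum, ← Finset.sum_sub_distrib]
    exact Finset.sum_congr rfl fun t ht => hacast t (Finset.mem_filter.mp ht).1
  have haout : ∀ p, N.outflow (fun t => (a t : ℤ)) p =
      (τ.length + 1) * N.outflow (fun t => (ζ.count t : ℤ)) p -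
        N.outflow (fun t => (τ.count t : ℤ)) p := by
    intro p
    simp only [outflow, Finset.mul_sum, ← Finset.sum_sub_distrib]
    exact Finset.sum_congr rfl fun t ht => hacast t (Finset.mem_filter.mp ht).1
  have hdiff : ∀ p ∈ N.places, N.inflow (fun t => (a t : ℤ)) p -
      N.outflow (fun t => (a t : ℤ)) p = M p - μh p := by
    intro p hp
    have h1 := hcyc.state_equation p
    have h2 := hτ.state_equation p
    rw [hν' p hp, hν p hp] at h1
    rw [hν p hp] at h2
    have h3 : N.inflow (fun t => (ζ.count t : ℤ)) p = N.outflow (fun t => (ζ.count t : ℤ)) p := by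
      linarith
    rw [hain, haout, h3]
    linarith
  intro p hp
  have h := inflow_eq_outflow_of_le hfc hl hb hw (a := a)
    (fun t ht => by have := hlt t ht; simp only [a]; omega)
    (fun q hq => by have := hdiff q hq; have := hle q hq; omega) hp
  have := hdiff p hp
  omega

end Conservation

section Clusters

variable {α : Type*} {N : Net α}

lemma clusterClosed_clusterOf (N : Net α) (x : α) : N.ClusterClosed (N.clusterOf x) :=
  ⟨fun p hp hpP t ht A hA => hA.2.1 p (hp A hA) hpP t ht,
    fun t ht htT p hp A hA => hA.2.2 t (ht A hA) htT p hp⟩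

lemma mem_clusterOf_self (N : Net α) (x : α) : x ∈ N.clusterOf x := fun _ hA => hA.1

lemma clusterOf_subset {A : Set α} {x : α} (hx : x ∈ A) (hA : N.ClusterClosed A) :
    N.clusterOf x ⊆ A := Set.sInter_subset_of_mem ⟨hx, hA⟩

lemma ClusterClosed.compl {A : Set α} (hA : N.ClusterClosed A) : N.ClusterClosed Aᶜ :=
  ⟨fun p hp hpP t ht h => hp (hA.2 t h (transition_of_place_F ht hpP) p ht),
    fun t ht htT p hp h => ht (hA.1 p h (place_of_F_transition hp htT) t hp)⟩

lemma clusterOf_eq_of_mem {x y : α} (h : y ∈ N.clusterOf x) : N.clusterOf x = N.clusterOf y := by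
  refine (clusterOf_subset ?_ (N.clusterClosed_clusterOf y)).antisymm
    (clusterOf_subset h (N.clusterClosed_clusterOf x))
  by_contra hx
  exact clusterOf_subset (Set.mem_compl hx) (N.clusterClosed_clusterOf y).compl h
    (N.mem_clusterOf_self y)

lemma clusterOf_subset_nodes [DecidableEq α] {x : α} (hx : x ∈ N.nodes) :
    N.clusterOf x ⊆ (N.nodes : Set α) :=
  clusterOf_subset hx
    ⟨fun _ _ hpP _ ht => Finset.mem_union_right _ (transition_of_place_F ht hpP),
      fun _ _ htT _ hp => Finset.mem_union_left _ (place_of_F_transition hp htT)⟩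

/-- The cluster of a transition of a free-choice net consists of its pre-places
and of the transitions sharing them. -/
lemma FreeChoice.mem_clusterOf_transition (hfc : N.FreeChoice) {t y : α}
    (ht : t ∈ N.transitions) (hy : y ∈ N.clusterOf t) :
    N.F y t ∨ y = t ∨ ∃ p, N.F p t ∧ N.F p y := by
  refine clusterOf_subset (A := {y | N.F y t ∨ y = t ∨ ∃ p, N.F p t ∧ N.F p y})
    (Or.inr (Or.inl rfl)) ⟨?_, ?_⟩ hy
  · rintro p (hp | rfl | ⟨q, hq, hqp⟩) hpP u hu
    · exact Or.inr (Or.inr ⟨p, hp, hu⟩)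
    · exact absurd ht (Finset.disjoint_left.mp N.disj hpP)
    · have hqP := place_of_F_transition hq ht
      exact absurd (transition_of_place_F hqp hqP) (Finset.disjoint_left.mp N.disj hpP)
  · rintro u (hu | rfl | ⟨q, hq, hqu⟩) huT p hp
    · exact absurd huT (Finset.disjoint_left.mp N.disj (place_of_F_transition hu ht))
    · exact Or.inl hp
    · exact Or.inl ((hfc.pre_iff (place_of_F_transition hq ht) hqu hq p).mp hp)

end Clusters

section Complement

variable {α : Type*} [DecidableEq α] {N : Net α} {S : Finset α}

lemma restrict_nodes_sdiff : (N.restrict (N.nodes \ S)).nodes = N.nodes \ S := by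
  ext x
  simp only [nodes, restrict, Finset.mem_union, Finset.mem_inter, Finset.mem_sdiff]
  tauto

lemma mem_restrict_transitions {t : α} :
    t ∈ (N.restrict (N.nodes \ S)).transitions ↔ t ∈ N.transitions ∧ t ∉ S := by
  simp only [nodes, restrict, Finset.mem_union, Finset.mem_inter, Finset.mem_sdiff]
  tauto

lemma mem_restrict_places {p : α} :
    p ∈ (N.restrict (N.nodes \ S)).places ↔ p ∈ N.places ∧ p ∉ S := by
  simp only [nodes, restrict, Finset.mem_union, Finset.mem_inter, Finset.mem_sdiff]
  tauto

lemma FreeChoice.restrict (hfc : N.FreeChoice) : (N.restrict S).FreeChoice := by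
  rintro p hp t ⟨-, -, h⟩ p' ⟨hp', -, h'⟩ t' ⟨-, ht', h''⟩
  exact ⟨hp', ht', hfc p (Finset.mem_inter.mp hp).1 t h p' h' t' h''⟩

lemma TransitionBordered.restrict_F_pre (hS : N.TransitionBordered S) {p t : α}
    (ht : t ∈ N.transitions) (htS : t ∉ S) :
    (N.restrict (N.nodes \ S)).F p t ↔ N.F p t := by
  refine ⟨fun h => h.2.2, fun h => ?_⟩
  have hp := place_of_F_transition h ht
  exact ⟨Finset.mem_sdiff.mpr ⟨Finset.mem_union_left _ hp,
    fun hpS => htS (hS p hpS hp t (Or.inr h))⟩,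
    Finset.mem_sdiff.mpr ⟨Finset.mem_union_right _ ht, htS⟩, h⟩

lemma TransitionBordered.restrict_F_post (hS : N.TransitionBordered S) {p t : α}
    (ht : t ∈ N.transitions) (htS : t ∉ S) :
    (N.restrict (N.nodes \ S)).F t p ↔ N.F t p := by
  refine ⟨fun h => h.2.2, fun h => ?_⟩
  have hp := place_of_transition_F h ht
  exact ⟨Finset.mem_sdiff.mpr ⟨Finset.mem_union_right _ ht, htS⟩,
    Finset.mem_sdiff.mpr ⟨Finset.mem_union_left _ hp,
    fun hpS => htS (hS p hpS hp t (Or.inl h))⟩, h⟩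

lemma TransitionBordered.restrict_enabled_iff (hS : N.TransitionBordered S) {M : α → ℕ} {t : α} :
    (N.restrict (N.nodes \ S)).Enabled M t ↔ N.Enabled M t ∧ t ∉ S := by
  unfold Enabled
  rw [mem_restrict_transitions]
  constructor
  · rintro ⟨⟨ht, htS⟩, h⟩
    exact ⟨⟨ht, fun p hp => h p ((hS.restrict_F_pre ht htS).mpr hp)⟩, htS⟩
  · rintro ⟨⟨ht, h⟩, htS⟩
    exact ⟨⟨ht, htS⟩, fun p hp => h p hp.2.2⟩

lemma TransitionBordered.restrict_fire (hS : N.TransitionBordered S) {t : α}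
    (ht : t ∈ N.transitions) (htS : t ∉ S) (M : α → ℕ) :
    (N.restrict (N.nodes \ S)).fire t M = N.fire t M := by
  funext p
  simp only [fire, hS.restrict_F_pre ht htS, hS.restrict_F_post ht htS]

/-- Occurrence sequences of the complement are occurrence sequences of the net
which leave the subnet untouched. -/
lemma TransitionBordered.reach_of_restrict (hS : N.TransitionBordered S) {M M' : α → ℕ}
    (h : (N.restrict (N.nodes \ S)).Reach M M') : N.Reach M M' ∧ ∀ p ∈ S, M' p = M p := by
  obtain ⟨σ, hσ⟩ := h
  induction hσ with
  | nil => exact ⟨Reach.refl _, fun _ _ => rfl⟩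
  | @cons μ ν t σ he _ ih =>
    obtain ⟨heN, htS⟩ := hS.restrict_enabled_iff.mp he
    rw [hS.restrict_fire heN.1 htS] at ih
    refine ⟨heN.reach_fire.trans ih.1, fun p hp => (ih.2 p hp).trans ?_⟩
    have h1 : ¬ N.F p t := fun h =>
      htS (hS p hp (place_of_F_transition h heN.1) t (Or.inr h))
    have h2 : ¬ N.F t p := fun h =>
      htS (hS p hp (place_of_transition_F h heN.1) t (Or.inl h))
    simp [fire, h1, h2]

lemma IsCPSubnet.exists_consumer (hS : N.IsCPSubnet S) {p : α} (hp : p ∈ N.places)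
    (hpS : p ∉ S) : ∃ t ∈ N.transitions, t ∉ S ∧ N.F p t := by
  obtain ⟨-, -, -, -, -, ⟨t₀, ht₀⟩, hsc⟩ := hS
  obtain ⟨ht₀S, ht₀T⟩ := Finset.mem_inter.mp ht₀
  rcases (hsc p (Finset.mem_sdiff.mpr ⟨Finset.mem_union_left _ hp, hpS⟩) t₀ ht₀S).cases_head with
    h | ⟨t, ht, -⟩
  · exact absurd (h ▸ ht₀T) (Finset.disjoint_left.mp N.disj hp)
  · exact ⟨t, transition_of_place_F ht.2.2 hp, (Finset.mem_sdiff.mp ht.2.1).2, ht.2.2⟩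

/-- A net with a CP-subnet having a way-in transition is weakly connected. -/
lemma IsCPSubnet.weaklyConnectedOn_nodes (hS : N.IsCPSubnet S) {tin : α}
    (htin : N.IsWayIn S tin) : N.WeaklyConnectedOn N.nodes := by
  obtain ⟨-, hSn, hw, -, -, -, hsc⟩ := hS
  obtain ⟨htS, htT, p, hp, hpS, hpt⟩ := htin
  set r := fun a b => a ∈ N.nodes ∧ b ∈ N.nodes ∧ (N.F a b ∨ N.F b a)
  have hsymm : ∀ a b, Relation.ReflTransGen r a b → Relation.ReflTransGen r b a :=
    fun a b h => by
      have : Std.Symm r := ⟨fun x y hxy => ⟨hxy.2.1, hxy.1, hxy.2.2.symm⟩⟩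
      exact symm h
  have htin : ∀ x ∈ N.nodes, Relation.ReflTransGen r x tin := by
    intro x hx
    by_cases hxS : x ∈ S
    · exact Relation.ReflTransGen.mono (fun a b h => ⟨hSn h.1, hSn h.2.1, h.2.2⟩) _ _
        (hw x hxS tin htS)
    · refine (Relation.ReflTransGen.mono (fun a b h => ?_) _ _
        (hsc x (Finset.mem_sdiff.mpr ⟨hx, hxS⟩) p
          (Finset.mem_sdiff.mpr ⟨Finset.mem_union_left _ hp, hpS⟩))).tail ?_
      · exact ⟨(Finset.mem_sdiff.mp h.1).1, (Finset.mem_sdiff.mp h.2.1).1, Or.inl h.2.2⟩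
      · exact ⟨Finset.mem_union_left _ hp, Finset.mem_union_right _ htT, Or.inl hpt⟩
  exact fun x hx y hy => (htin x hx).trans (hsymm _ _ (htin y hy))

/-- The cluster of a transition outside a transition-bordered subnet restricts to the
cluster of that transition in the complement. -/
lemma TransitionBordered.clusterOf_restrict (hS : N.TransitionBordered S) (hfc : N.FreeChoice)
    {t : α} (ht : t ∈ N.transitions) (htS : t ∉ S) :
    N.clusterOf t ∩ ((N.nodes \ S : Finset α) : Set α) =
      (N.restrict (N.nodes \ S)).clusterOf t := by
  have htn : t ∈ N.nodes := Finset.mem_union_right _ ht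
  have htR : t ∈ (N.restrict (N.nodes \ S)).transitions := mem_restrict_transitions.mpr ⟨ht, htS⟩
  have hcl := (N.restrict (N.nodes \ S)).clusterClosed_clusterOf t
  have hpre : ∀ p, N.F p t → p ∈ (N.restrict (N.nodes \ S)).clusterOf t := fun p hp =>
    hcl.2 t (mem_clusterOf_self _ _) htR p ((hS.restrict_F_pre ht htS).mpr hp)
  refine Set.Subset.antisymm ?_ (clusterOf_subset ⟨N.mem_clusterOf_self t, ?_⟩ ⟨?_, ?_⟩)
  · rintro y ⟨hy, hyS⟩
    rcases hfc.mem_clusterOf_transition ht hy with h | rfl | ⟨p, hpt, hpy⟩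
    · exact hpre y h
    · exact mem_clusterOf_self _ _
    · have hpt' := (hS.restrict_F_pre ht htS).mpr hpt
      exact hcl.1 p (hpre p hpt) (place_of_F_transition hpt' htR) y ⟨hpt'.1, hyS, hpy⟩
  · exact Finset.mem_coe.mpr (Finset.mem_sdiff.mpr ⟨htn, htS⟩)
  · rintro p ⟨hp, -⟩ hpP u hu
    exact ⟨(N.clusterClosed_clusterOf t).1 p hp (mem_restrict_places.mp hpP).1 u hu.2.2, hu.2.1⟩
  · rintro u ⟨hu, -⟩ huT p hp
    exact ⟨(N.clusterClosed_clusterOf t).2 u hu (mem_restrict_transitions.mp huT).1 p hp.2.2,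
      hp.1⟩

/-- After a shutdown of a CP-subnet, the complement is live. -/
lemma IsCPSubnet.live_restrict (hS : N.IsCPSubnet S) (hfc : N.FreeChoice) {μsd : α → ℕ}
    (hl : N.Live μsd) (hb : (N.restrict (N.nodes \ S)).Bounded μsd) {tin : α}
    (htin : N.IsWayIn S tin)
    (hsd : ∀ t ∈ S, t ∈ N.transitions → t ≠ tin → ¬ N.Enabled μsd t) :
    (N.restrict (N.nodes \ S)).Live μsd := by
  have hbord : N.TransitionBordered S := hS.2.2.2.1
  refine live_of_deadlockFree hfc.restrict hb ?_ fun M hM => ?_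
  · intro x hx y hy
    rw [restrict_nodes_sdiff] at *
    exact Relation.ReflTransGen.mono (fun a b h => ⟨h.1, h.2.1, h⟩) _ _
      (hS.2.2.2.2.2.2 x hx y hy)
  · obtain ⟨hMN, hMS⟩ := hbord.reach_of_restrict hM
    obtain ⟨t, ht⟩ := (hl.liveAt hMN htin.2.1).exists_enabled
    by_cases htS : t ∈ S
    swap
    · exact ⟨t, hbord.restrict_enabled_iff.mpr ⟨ht, htS⟩⟩
    by_cases hway : N.IsWayIn S t
    · obtain ⟨-, -, p, hp, hpS, hpt⟩ := hway
      obtain ⟨u, hu, huS, hpu⟩ := hS.exists_consumer hp hpS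
      exact ⟨u, hbord.restrict_enabled_iff.mpr
        ⟨ht.of_pre_iff hu (hfc.pre_iff hp hpt hpu), huS⟩⟩
    · refine absurd ⟨ht.1, fun p hp => ?_⟩ (hsd t htS ht.1 fun h => hway (h ▸ htin))
      have hpS : p ∈ S := by
        by_contra hpS
        exact hway ⟨htS, ht.1, p, place_of_F_transition hp ht.1, hpS, hp⟩
      rw [← hMS p hpS]
      exact ht.2 p hp

end Complement

end Net

/-- **Propagating perpetuality to the complement.** Let `(N, μ₀)` be a
perpetual free-choice system with regeneration cluster `cl`, let `S` span a
`cl`-adapted CP-subnet with way-in transition `tin`. Then for every reachable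
marking `μ` and every shutdown sequence `μ →σ→ μ_sd` for the subnet at `μ`,
the free-choice system `(N̄, μ_sd|N̄)` on the complement `N̄ = N ∖ N̂` is
perpetual with regeneration cluster `cl̄ = N̄ ∩ cl`. -/
theorem complement_perpetual_of_adapted_cpSubnet
    {α : Type*} [DecidableEq α] (N : Net α) (μ₀ : α → ℕ) (cl : Set α)
    (hfc : N.FreeChoice) (hperp : N.Perpetual μ₀ cl)
    (S : Finset α) (hS : N.IsCPSubnet S) (had : ¬ cl ⊆ (S : Set α))
    (tin : α) (htin : N.IsWayIn S tin)
    (μ : α → ℕ) (hμ : N.Reach μ₀ μ)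
    (σ : List α) (μsd : α → ℕ) (hsd : N.IsShutdownSeq S tin μ σ μsd) :
    (N.restrict (N.nodes \ S)).Perpetual μsd
      (cl ∩ ((N.nodes \ S : Finset α) : Set α)) := by
  obtain ⟨hl, hb, ⟨x, hx, rfl⟩, hh⟩ := hperp
  have hbord : N.TransitionBordered S := hS.2.2.2.1
  have hsdR : N.Reach μ₀ μsd := hμ.trans ⟨σ, hsd.1⟩
  have hb' : (N.restrict (N.nodes \ S)).Bounded μsd := by
    obtain ⟨K, hK⟩ := hb
    exact ⟨K, fun M hM p hp => hK M (hsdR.trans (hbord.reach_of_restrict hM).1) p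
      (Net.mem_restrict_places.mp hp).1⟩
  have hl' := hS.live_restrict hfc (fun t ht M hM => hl t ht M (hsdR.trans hM)) hb' htin hsd.2.2
  obtain ⟨t, ht, htS, htcl⟩ : ∃ t ∈ N.transitions, t ∉ S ∧ t ∈ N.clusterOf x := by
    obtain ⟨y, hy, hyS⟩ := Set.not_subset.mp had
    rcases Finset.mem_union.mp (Net.clusterOf_subset_nodes hx hy) with h | h
    · obtain ⟨t, ht, htS, hyt⟩ := hS.exists_consumer h hyS
      exact ⟨t, ht, htS, (N.clusterClosed_clusterOf x).1 y hy h t hyt⟩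
    · exact ⟨y, h, hyS, hy⟩
  rw [Net.clusterOf_eq_of_mem htcl] at hh ⊢
  have htR := Net.mem_restrict_transitions.mpr ⟨ht, htS⟩
  refine ⟨hl', hb', ⟨t, Finset.mem_union_right _ htR, hbord.clusterOf_restrict hfc ht htS⟩, ?_⟩
  intro M hM
  obtain ⟨ν, hν, he⟩ := hl' t htR M hM
  refine ⟨ν, hν, ?_⟩
  have heN := (hbord.restrict_enabled_iff.mp he).1
  have heq : N.MarkingEq ν (N.clusterMarking (N.clusterOf t)) := by
    refine hh.eq_of_le hfc hl hb (hS.weaklyConnectedOn_nodes htin)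
      (hsdR.trans (hbord.reach_of_restrict (hM.trans hν)).1) fun p hp => ?_
    unfold Net.clusterMarking
    split_ifs with h
    · rcases hfc.mem_clusterOf_transition ht h.1 with h1 | rfl | ⟨q, hqt, hqp⟩
      · exact heN.2 p h1
      · exact absurd ht (Finset.disjoint_left.mp N.disj hp)
      · exact absurd (Net.transition_of_place_F hqp (Net.place_of_F_transition hqt ht))
          (Finset.disjoint_left.mp N.disj hp)
    · exact Nat.zero_le _
  intro p hp
  obtain ⟨hpP, hpS⟩ := Net.mem_restrict_places.mp hp
  rw [heq p hpP]
  have hpn : p ∈ ((N.nodes \ S : Finset α) : Set α) :=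
    Finset.mem_coe.mpr (Finset.mem_sdiff.mpr ⟨Finset.mem_union_left _ hpP, hpS⟩)
  simp only [Net.clusterMarking, Set.mem_inter_iff, hpn, hp, hpP, and_true]
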